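/- Let λ ∈ k^c be nonzero and let M be a finitely generated left A-module. Then M is projective as a module over the subalgebra k[u_λ] of A generated by u_λ if and only if Ext^1_A(Au_λ, M) = 0. -/

import Mathlib

open scoped TensorProduct

/-- The relations defining the quantum complete intersection `A^c_q`:
`x_i ^ a = 0` for all `i`, and `x_i x_j = q • x_j x_i` for `i < j`. -/
inductive QCIRel (k : Type) [Field k] (c a : ℕ) (q : k) :
    FreeAlgebra k (Fin c) → FreeAlgebra k (Fin c) → Prop
  | pow (i : Fin c) : QCIRel k c a q (FreeAlgebra.ι k i ^ a) 0
  | comm (i j : Fin c) (hij : i < j) :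
      QCIRel k c a q (FreeAlgebra.ι k i * FreeAlgebra.ι k j)
        (q • (FreeAlgebra.ι k j * FreeAlgebra.ι k i))

/-- The quantum complete intersection algebra `A^c_q = k⟨x_1,…,x_c⟩/(x_i^a, x_ix_j - q x_jx_i)`. -/
def QCI (k : Type) [Field k] (c a : ℕ) (q : k) : Type := RingQuot (QCIRel k c a q)

noncomputable instance (k : Type) [Field k] (c a : ℕ) (q : k) : Ring (QCI k c a q) :=
  inferInstanceAs (Ring (RingQuot (QCIRel k c a q)))

noncomputable instance (k : Type) [Field k] (c a : ℕ) (q : k) : Algebra k (QCI k c a q) :=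
  inferInstanceAs (Algebra k (RingQuot (QCIRel k c a q)))

namespace QCI

variable (k : Type) [Field k] (c a : ℕ) (q : k)

/-- The generators `x_i` of the quantum complete intersection. -/
noncomputable def x (i : Fin c) : QCI k c a q :=
  RingQuot.mkAlgHom k (QCIRel k c a q) (FreeAlgebra.ι k i)

/-- The element `u_λ = λ_1 x_1 + ⋯ + λ_c x_c` of `A^c_q`. -/
noncomputable def u (lam : Fin c → k) : QCI k c a q :=
  ∑ i, lam i • QCI.x k c a q i

end QCI

/-- `a' = a / gcd(a, char k)` if `char k > 0`, and `a' = a` if `char k = 0`. -/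
noncomputable def aprime (k : Type) [Field k] (a : ℕ) : ℕ :=
  if ringChar k > 0 then a / Nat.gcd a (ringChar k) else a

open CategoryTheory

set_option synthInstance.maxHeartbeats 400000

/-- The Gaussian binomial coefficients, defined by the `q`-Pascal recursion. -/
def gaussCoeff {k : Type*} [Semiring k] (q : k) : ℕ → ℕ → k
  | _, 0 => 1
  | 0, _ + 1 => 0
  | n + 1, i + 1 => gaussCoeff q n i + q ^ (i + 1) * gaussCoeff q n (i + 1)

theorem gaussCoeff_zero_right {k : Type*} [Semiring k] (q : k) (n : ℕ) :
    gaussCoeff q n 0 = 1 := by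
  cases n <;> rfl

theorem gaussCoeff_succ_succ {k : Type*} [Semiring k] (q : k) (n i : ℕ) :
    gaussCoeff q (n + 1) (i + 1) = gaussCoeff q n i + q ^ (i + 1) * gaussCoeff q n (i + 1) :=
  rfl

theorem gaussCoeff_eq_zero_of_lt {k : Type*} [Semiring k] (q : k) {n i : ℕ} (h : n < i) :
    gaussCoeff q n i = 0 := by
  induction n generalizing i with
  | zero =>
    obtain ⟨i, rfl⟩ := Nat.exists_eq_add_one_of_ne_zero h.ne'
    rfl
  | succ n ih =>
    obtain ⟨i, rfl⟩ := Nat.exists_eq_add_one_of_ne_zero (by omega : i ≠ 0)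
    rw [gaussCoeff_succ_succ, ih (by omega), ih (by omega), mul_zero, add_zero]

theorem gaussCoeff_self {k : Type*} [Semiring k] (q : k) (n : ℕ) : gaussCoeff q n n = 1 := by
  induction n with
  | zero => rfl
  | succ n ih => rw [gaussCoeff_succ_succ, ih, gaussCoeff_eq_zero_of_lt q n.lt_succ_self,
      mul_zero, add_zero]

theorem one_sub_pow_mul_gaussCoeff_succ {k : Type*} [CommRing k] (q : k) (i d : ℕ) :
    (1 - q ^ (i + 1)) * gaussCoeff q (i + d) (i + 1) = (1 - q ^ d) * gaussCoeff q (i + d) i := by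
  obtain ⟨n, hn⟩ : ∃ n, n = i + d := ⟨_, rfl⟩
  induction n generalizing i d with
  | zero =>
    obtain ⟨rfl, rfl⟩ : i = 0 ∧ d = 0 := by omega
    simp [gaussCoeff]
  | succ n ih =>
    rcases d with - | e
    · simp [gaussCoeff_eq_zero_of_lt]
    rcases i with - | j
    · have h := ih 0 e (by omega)
      obtain rfl : n = e := by omega
      simp only [zero_add, gaussCoeff_succ_succ, gaussCoeff_zero_right] at h ⊢
      linear_combination q * h
    · have h₁ := ih (j + 1) e (by omega)
      have h₂ := ih j (e + 1) (by omega)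
      rw [show j + 1 + e = n by omega] at h₁
      rw [show j + (e + 1) = n by omega] at h₂
      rw [← hn, gaussCoeff_succ_succ, gaussCoeff_succ_succ]
      linear_combination q ^ (j + 2) * h₁ + h₂

theorem IsPrimitiveRoot.gaussCoeff_eq_zero {k : Type*} [CommRing k] [IsDomain k] {q : k} {n : ℕ}
    (hq : IsPrimitiveRoot q n) {i : ℕ} (hi : i + 1 < n) : gaussCoeff q n (i + 1) = 0 := by
  induction i with
  | zero =>
    have h := one_sub_pow_mul_gaussCoeff_succ q 0 n
    simp only [zero_add, hq.pow_eq_one, sub_self, zero_mul] at h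
    exact (mul_eq_zero.1 h).resolve_left
      (sub_ne_zero.2 (hq.pow_ne_one_of_pos_of_lt one_ne_zero hi).symm)
  | succ i ih =>
    obtain ⟨d, hd⟩ := Nat.exists_eq_add_of_le (by omega : i + 1 ≤ n)
    have h := one_sub_pow_mul_gaussCoeff_succ q (i + 1) d
    rw [← hd, ih (by omega), mul_zero] at h
    exact (mul_eq_zero.1 h).resolve_left
      (sub_ne_zero.2 (hq.pow_ne_one_of_pos_of_lt (Nat.succ_ne_zero _) hi).symm)

section SkewCommuting

variable {k A : Type*} [CommRing k] [Ring A] [Algebra k A]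

theorem mul_pow_of_skew {q : k} {x y : A} (h : x * y = q • (y * x)) (n : ℕ) :
    x * y ^ n = q ^ n • (y ^ n * x) := by
  induction n with
  | zero => simp
  | succ n ih =>
    rw [pow_succ, ← mul_assoc, ih, smul_mul_assoc, mul_assoc, h, mul_smul_comm, smul_smul,
      mul_assoc, pow_succ]

theorem pow_mul_pow_of_skew {q : k} {x y : A} (h : x * y = q • (y * x)) (m n : ℕ) :
    x ^ m * y ^ n = q ^ (n * m) • (y ^ n * x ^ m) := by
  induction m with
  | zero => simp
  | succ m ih =>
    rw [pow_succ', mul_assoc, ih, mul_smul_comm, ← mul_assoc, mul_pow_of_skew h, smul_mul_assoc,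
      smul_smul, mul_assoc, ← pow_add, mul_add_one]

theorem add_pow_of_skew {q : k} {x y : A} (h : x * y = q • (y * x)) (n : ℕ) :
    (x + y) ^ n = ∑ i ∈ Finset.range (n + 1), gaussCoeff q n i • (y ^ i * x ^ (n - i)) := by
  induction n with
  | zero => simp [gaussCoeff]
  | succ n ih =>
    have h₁ : ∀ i ∈ Finset.range (n + 1),
        x * (gaussCoeff q n i • (y ^ i * x ^ (n - i))) =
          (q ^ i * gaussCoeff q n i) • (y ^ i * x ^ (n + 1 - i)) := by
      intro i hi
      rw [mul_smul_comm, ← mul_assoc, mul_pow_of_skew h, smul_mul_assoc, smul_smul, mul_assoc,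
        ← pow_succ', mul_comm, Nat.sub_add_comm (Finset.mem_range_succ_iff.1 hi)]
    have h₂ : ∀ i ∈ Finset.range (n + 1),
        y * (gaussCoeff q n i • (y ^ i * x ^ (n - i))) =
          gaussCoeff q n i • (y ^ (i + 1) * x ^ (n - i)) := by
      intro i _
      rw [mul_smul_comm, ← mul_assoc, ← pow_succ']
    rw [pow_succ', ih, add_mul, Finset.mul_sum, Finset.mul_sum, Finset.sum_congr rfl h₁,
      Finset.sum_congr rfl h₂, Finset.sum_range_succ' _ (n + 1)]
    have h₃ := Finset.sum_range_succ
      (fun i ↦ (q ^ i * gaussCoeff q n i) • (y ^ i * x ^ (n + 1 - i))) (n + 1)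
    rw [gaussCoeff_eq_zero_of_lt q n.lt_succ_self, mul_zero, zero_smul, add_zero] at h₃
    rw [← h₃, Finset.sum_range_succ' _ (n + 1), add_right_comm, ← Finset.sum_add_distrib]
    congr 1
    · refine Finset.sum_congr rfl fun i _ ↦ ?_
      rw [gaussCoeff_succ_succ, add_comm (gaussCoeff q n i), add_smul, Nat.add_sub_add_right]
    · simp [gaussCoeff_zero_right]

theorem IsPrimitiveRoot.add_pow_of_skew [IsDomain k] {q : k} {n : ℕ} (hq : IsPrimitiveRoot q n)
    (hn : n ≠ 0) {x y : A} (h : x * y = q • (y * x)) : (x + y) ^ n = x ^ n + y ^ n := by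
  obtain ⟨n, rfl⟩ := Nat.exists_eq_add_one_of_ne_zero hn
  rw [_root_.add_pow_of_skew h, Finset.sum_range_succ, Finset.sum_range_succ',
    Finset.sum_eq_zero fun i hi ↦ ?_]
  · simp [gaussCoeff_self, gaussCoeff_zero_right]
  · rw [hq.gaussCoeff_eq_zero (by simpa using hi), zero_smul]

theorem Finset.sum_pow_of_skew {ι : Type*} [LinearOrder ι] {q : k} {n : ℕ} (hn : n ≠ 0)
    (hadd : ∀ x y : A, x * y = q • (y * x) → (x + y) ^ n = x ^ n + y ^ n)
    {f : ι → A} (hf : ∀ i j, i < j → f i * f j = q • (f j * f i)) (s : Finset ι) :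
    (∑ i ∈ s, f i) ^ n = ∑ i ∈ s, f i ^ n := by
  induction s using Finset.induction_on_max with
  | empty => simp [hn]
  | insert i s hi ih =>
    have his : i ∉ s := fun h ↦ (hi i h).false
    rw [Finset.sum_insert his, Finset.sum_insert his, add_comm, hadd, ih, add_comm]
    rw [Finset.sum_mul, Finset.mul_sum, Finset.smul_sum]
    exact Finset.sum_congr rfl fun j hj ↦ hf j i (hi j hj)

end SkewCommuting

namespace QCI

variable {k : Type} [Field k] {c a : ℕ} {q : k}

theorem x_pow (i : Fin c) : x k c a q i ^ a = 0 := by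
  have := RingQuot.mkAlgHom_rel k (QCIRel.pow (k := k) (c := c) (a := a) (q := q) i)
  simpa [x] using! this

theorem x_mul_x {i j : Fin c} (hij : i < j) :
    x k c a q i * x k c a q j = q • (x k c a q j * x k c a q i) := by
  have := RingQuot.mkAlgHom_rel k (QCIRel.comm (k := k) (c := c) (a := a) (q := q) i j hij)
  simpa [x] using! this

theorem aprime_ne_zero (ha : a ≠ 0) : aprime k a ≠ 0 := by
  unfold aprime
  split_ifs with h
  · exact (Nat.div_pos (Nat.gcd_le_left _ (Nat.pos_of_ne_zero ha))
      (Nat.gcd_pos_of_pos_right _ h)).ne'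
  · exact ha

theorem aprime_eq_or (k : Type) [Field k] (a : ℕ) :
    aprime k a = a ∨ (ringChar k).Prime ∧ aprime k a * ringChar k = a := by
  unfold aprime
  split_ifs with h
  · have hp := (CharP.char_is_prime_or_zero k (ringChar k)).resolve_right h.ne'
    rcases (Nat.dvd_prime hp).1 (Nat.gcd_dvd_right a (ringChar k)) with h1 | h1
    · simp [h1]
    · exact .inr ⟨hp, by rw [h1, Nat.div_mul_cancel (h1 ▸ Nat.gcd_dvd_left a _)]⟩
  · exact .inl rfl

theorem lam_smul_x_skew (lam : Fin c → k) (i j : Fin c) (hij : i < j) :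
    (lam i • x k c a q i) * (lam j • x k c a q j) =
      q • ((lam j • x k c a q j) * (lam i • x k c a q i)) := by
  rw [smul_mul_smul_comm, smul_mul_smul_comm, x_mul_x hij, smul_comm, mul_comm (lam i)]

theorem u_pow [Nontrivial (QCI k c a q)] (ha : a ≠ 0) (hq : IsPrimitiveRoot q (aprime k a))
    (lam : Fin c → k) : u k c a q lam ^ a = 0 := by
  have h0 := aprime_ne_zero (k := k) ha
  have hsum := Finset.sum_pow_of_skew h0
    (fun (x y : QCI k c a q) ↦ hq.add_pow_of_skew h0) (lam_smul_x_skew lam) Finset.univ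
  have hx : ∀ i, (lam i • x k c a q i) ^ a = 0 := fun i ↦ by rw [smul_pow, x_pow, smul_zero]
  rcases aprime_eq_or k a with h | ⟨hp, h⟩
  · rw [h] at hsum
    rw [u, hsum, Finset.sum_eq_zero fun i _ ↦ hx i]
  · have : Fact (ringChar k).Prime := ⟨hp⟩
    have : CharP (QCI k c a q) (ringChar k) := charP_of_injective_algebraMap' k _
    have hsum2 := Finset.sum_pow_of_skew (q := (1 : k)) hp.ne_zero
      (fun (x y : QCI k c a q) hxy ↦ add_pow_char_of_commute (ringChar k)
        (show Commute x y by rwa [one_smul] at hxy))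
      (f := fun i ↦ (lam i • x k c a q i) ^ aprime k a) (fun i j hij ↦ by
        rw [pow_mul_pow_of_skew (lam_smul_x_skew lam i j hij), pow_mul, hq.pow_eq_one, one_pow])
      Finset.univ
    have hu : u k c a q lam ^ (aprime k a * ringChar k) = 0 := by
      rw [u, pow_mul, hsum, hsum2, Finset.sum_eq_zero]
      intro i _
      rw [← pow_mul, h, hx]
    rwa [h] at hu

/-- The action of `x_i` on the space with basis the exponent vectors `n`, modelled on
left multiplication on ordered monomials. -/
noncomputable def monomialAct (k : Type) [Field k] {c : ℕ} (a : ℕ) (q : k) (i : Fin c) :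
    Module.End k ((Fin c → ℕ) →₀ k) :=
  Finsupp.linearCombination k fun n ↦
    if n i + 1 < a then Finsupp.single (n + Pi.single i 1) (q ^ ∑ j ∈ Finset.Ioi i, n j) else 0

theorem monomialAct_single (i : Fin c) (n : Fin c → ℕ) (r : k) :
    monomialAct k a q i (Finsupp.single n r) = if n i + 1 < a then
      Finsupp.single (n + Pi.single i 1) (r * q ^ ∑ j ∈ Finset.Ioi i, n j) else 0 := by
  rw [monomialAct, Finsupp.linearCombination_single]
  split_ifs <;> simp

theorem exists_monomialAct_pow_single (i : Fin c) (n : Fin c → ℕ) (r : k) (m : ℕ) :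
    ∃ s : k, (monomialAct k a q i ^ (m + 1)) (Finsupp.single n r) =
      if n i + (m + 1) < a then Finsupp.single (n + Pi.single i (m + 1)) s else 0 := by
  induction m with
  | zero => exact ⟨_, by rw [zero_add, pow_one, monomialAct_single]⟩
  | succ m ih =>
    obtain ⟨s, hs⟩ := ih
    rw [pow_succ', Module.End.mul_apply, hs]
    by_cases h : n i + (m + 1) < a
    · rw [if_pos h, monomialAct_single]
      refine ⟨s * q ^ ∑ j ∈ Finset.Ioi i, (n + Pi.single i (m + 1) : Fin c → ℕ) j, ?_⟩
      rw [add_assoc n, ← Pi.single_add]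
      simp only [Pi.add_apply, Pi.single_eq_same, add_assoc]
    · exact ⟨0, by rw [if_neg h, map_zero, if_neg (by omega)]⟩

theorem monomialAct_pow (ha : a ≠ 0) (i : Fin c) : monomialAct k a q i ^ a = 0 := by
  obtain ⟨m, rfl⟩ := Nat.exists_eq_add_one_of_ne_zero ha
  refine Finsupp.lhom_ext fun n r ↦ ?_
  obtain ⟨s, hs⟩ := exists_monomialAct_pow_single (a := m + 1) (q := q) i n r m
  rw [hs, if_neg (by omega), LinearMap.zero_apply]

theorem monomialAct_mul {i j : Fin c} (hij : i < j) :
    monomialAct k a q i * monomialAct k a q j =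
      q • (monomialAct k a q j * monomialAct k a q i) := by
  refine Finsupp.lhom_ext fun n r ↦ ?_
  have hji : (Pi.single j 1 : Fin c → ℕ) i = 0 := Pi.single_eq_of_ne hij.ne _
  have hij' : (Pi.single i 1 : Fin c → ℕ) j = 0 := Pi.single_eq_of_ne hij.ne' _
  have h₁ : ∑ l ∈ Finset.Ioi i, (Pi.single j 1 : Fin c → ℕ) l = 1 := by
    rw [Finset.sum_pi_single', if_pos (by simpa using hij)]
  have h₂ : ∑ l ∈ Finset.Ioi j, (Pi.single i 1 : Fin c → ℕ) l = 0 := by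
    rw [Finset.sum_pi_single', if_neg (by simpa using hij.le)]
  simp only [Module.End.mul_apply, LinearMap.smul_apply, monomialAct_single, apply_ite, map_zero,
    Pi.add_apply, hji, hij', add_zero, Finset.sum_add_distrib, h₁, h₂]
  split_ifs
  · rw [Finsupp.smul_single, add_right_comm, smul_eq_mul]
    congr 1
    ring
  all_goals simp

/-- The representation of the quantum complete intersection on exponent vectors. -/
noncomputable def monomialRep (q : k) (ha : a ≠ 0) :
    QCI k c a q →ₐ[k] Module.End k ((Fin c → ℕ) →₀ k) :=
  RingQuot.liftAlgHom k ⟨FreeAlgebra.lift k (monomialAct k a q), fun r s h ↦ by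
    cases h with
    | pow i => simp [monomialAct_pow ha]
    | comm i j hij => simp [monomialAct_mul hij]⟩

theorem monomialRep_x (ha : a ≠ 0) (i : Fin c) :
    monomialRep q ha (x k c a q i) = monomialAct k a q i := by
  simp only [monomialRep, x]
  erw [RingQuot.liftAlgHom_mkAlgHom_apply]
  simp

theorem single_mem_range_monomialRep (ha : a ≠ 0) (hq : q ≠ 0) {n : Fin c → ℕ}
    (hn : ∀ i, n i < a) : Finsupp.single n (1 : k) ∈ LinearMap.range
      ((LinearMap.applyₗ (Finsupp.single 0 (1 : k))).comp (monomialRep q ha).toLinearMap) := by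
  obtain ⟨d, hd⟩ : ∃ d, d = ∑ i, n i := ⟨_, rfl⟩
  induction d generalizing n with
  | zero =>
    obtain rfl : n = 0 := by
      ext i
      exact Finset.sum_eq_zero_iff.1 hd.symm i (Finset.mem_univ i)
    exact ⟨1, by simp⟩
  | succ d ih =>
    obtain ⟨i, hi⟩ : ∃ i, n i ≠ 0 := by
      by_contra! h
      simp [h] at hd
    have hle : Pi.single i 1 ≤ n := by
      intro j
      obtain rfl | hj := eq_or_ne j i
      · simpa [Nat.one_le_iff_ne_zero] using hi
      · simp [hj]
    obtain ⟨m, rfl⟩ := exists_add_of_le hle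
    obtain ⟨r, hr⟩ := ih (n := m) (fun j ↦ (Nat.le_add_left _ _).trans_lt (hn j)) (by
      simp only [Pi.add_apply, Finset.sum_add_distrib, Finset.sum_pi_single', Finset.mem_univ,
        if_true] at hd
      omega)
    have him := hn i
    simp only [Pi.add_apply, Pi.single_eq_same] at him
    refine ⟨(q ^ ∑ j ∈ Finset.Ioi i, m j)⁻¹ • (x k c a q i * r), ?_⟩
    simp only [LinearMap.comp_apply, AlgHom.toLinearMap_apply, LinearMap.applyₗ_apply_apply]
      at hr ⊢
    rw [map_smul, map_mul, LinearMap.smul_apply, Module.End.mul_apply, hr, monomialRep_x,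
      monomialAct_single, if_pos (by omega), Finsupp.smul_single, one_mul, smul_eq_mul,
      inv_mul_cancel₀ (pow_ne_zero _ hq), add_comm]

theorem nontrivial (ha : a ≠ 0) : Nontrivial (QCI k c a q) :=
  (monomialRep q ha).toRingHom.domain_nontrivial

theorem pow_le_finrank [FiniteDimensional k (QCI k c a q)] (ha : a ≠ 0) (hq : q ≠ 0) :
    a ^ c ≤ Module.finrank k (QCI k c a q) := by
  let v : (Fin c → Fin a) → ((Fin c → ℕ) →₀ k) := fun n ↦ Finsupp.single (fun i ↦ (n i : ℕ)) 1
  have hv : LinearIndependent k v :=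
    (Finsupp.basisSingleOne (R := k) (ι := Fin c → ℕ)).linearIndependent.comp
      (fun (n : Fin c → Fin a) i ↦ (n i : ℕ)) (fun m n h ↦ funext fun i ↦ Fin.ext (congrFun h i))
  have h := finrank_span_eq_card hv
  rw [Fintype.card_fun, Fintype.card_fin, Fintype.card_fin] at h
  rw [← h]
  refine (Submodule.finrank_mono (Submodule.span_le.2 ?_)).trans
    (LinearMap.finrank_range_le
      ((LinearMap.applyₗ (Finsupp.single 0 (1 : k))).comp (monomialRep q ha).toLinearMap))
  rintro _ ⟨n, rfl⟩
  exact single_mem_range_monomialRep ha hq fun i ↦ (n i).2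

end QCI

section PowerSpan

variable {k A : Type*} [Field k] [Ring A] [Algebra k A]

/-- The linear span of the powers of an element. -/
def powerSpan (k : Type*) {A : Type*} [Field k] [Ring A] [Algebra k A] (x : A) : Submodule k A :=
  Submodule.span k (Submonoid.powers x)

theorem pow_mem_powerSpan (x : A) (n : ℕ) : x ^ n ∈ powerSpan k x :=
  Submodule.subset_span ⟨n, rfl⟩

theorem one_mem_powerSpan (x : A) : 1 ∈ powerSpan k x := by
  simpa using pow_mem_powerSpan (k := k) x 0

theorem self_mem_powerSpan (x : A) : x ∈ powerSpan k x := by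
  simpa using pow_mem_powerSpan (k := k) x 1

theorem powerSpan_mul_self (x : A) : powerSpan k x * powerSpan k x = powerSpan k x := by
  rw [powerSpan, Submodule.span_mul_span, Submonoid.coe_mul_self_eq]

theorem span_singleton_mul_powerSpan_le (x : A) : (k ∙ x) * powerSpan k x ≤ powerSpan k x :=
  (mul_le_mul_left ((Submodule.span_singleton_le_iff_mem _ _).2 (self_mem_powerSpan x)) _).trans
    (powerSpan_mul_self x).le

theorem powerSpan_eq_span_range {x : A} {a : ℕ} (hx : x ^ a = 0) :
    powerSpan k x = Submodule.span k (Set.range fun i : Fin a ↦ x ^ (i : ℕ)) := by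
  refine le_antisymm (Submodule.span_le.2 ?_) (Submodule.span_mono ?_)
  · rintro _ ⟨n, rfl⟩
    by_cases h : n < a
    · exact Submodule.subset_span ⟨⟨n, h⟩, rfl⟩
    · simp [pow_eq_zero_of_le (not_lt.1 h) hx]
  · rintro _ ⟨i, rfl⟩
    exact ⟨i, rfl⟩

theorem finite_powerSpan {x : A} {a : ℕ} (hx : x ^ a = 0) :
    Module.Finite k (powerSpan k x) := by
  rw [powerSpan_eq_span_range hx]
  exact Module.Finite.span_of_finite k (Set.finite_range _)

theorem finrank_powerSpan_le {x : A} {a : ℕ} (hx : x ^ a = 0) :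
    Module.finrank k (powerSpan k x) ≤ a := by
  rw [powerSpan_eq_span_range hx]
  exact (finrank_range_le_card (R := k) fun i : Fin a ↦ x ^ (i : ℕ)).trans_eq (by simp)

theorem commute_span_span_of_skew {s t : Set A}
    (h : ∀ x ∈ s, ∀ y ∈ t, ∃ r : k, r ≠ 0 ∧ x * y = r • (y * x)) :
    Commute (Submodule.span k s) (Submodule.span k t) := by
  rw [commute_iff_eq, Submodule.span_mul_span, Submodule.span_mul_span]
  refine le_antisymm (Submodule.span_le.2 ?_) (Submodule.span_le.2 ?_)
  · rintro _ ⟨x, hx, y, hy, rfl⟩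
    obtain ⟨r, -, hxy⟩ := h x hx y hy
    simp only [hxy]
    exact Submodule.smul_mem _ _ (Submodule.subset_span ⟨y, hy, x, hx, rfl⟩)
  · rintro _ ⟨y, hy, x, hx, rfl⟩
    obtain ⟨r, hr, hxy⟩ := h x hx y hy
    replace hxy := (inv_smul_eq_iff₀ hr).2 hxy
    simp only [← hxy]
    exact Submodule.smul_mem _ _ (Submodule.subset_span ⟨x, hx, y, hy, rfl⟩)

theorem commute_powerSpan_of_skew {x y : A} {r : k} (hr : r ≠ 0) (h : x * y = r • (y * x)) :
    Commute (powerSpan k x) (powerSpan k y) := by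
  refine commute_span_span_of_skew ?_
  rintro _ ⟨m, rfl⟩ _ ⟨n, rfl⟩
  exact ⟨_, pow_ne_zero _ hr, pow_mul_pow_of_skew h m n⟩

theorem commute_span_singleton_powerSpan_of_skew {x y : A} {r : k} (hr : r ≠ 0)
    (h : x * y = r • (y * x)) : Commute (k ∙ x) (powerSpan k y) := by
  refine commute_span_span_of_skew ?_
  rintro _ rfl _ ⟨n, rfl⟩
  exact ⟨_, pow_ne_zero _ hr, mul_pow_of_skew h n⟩

theorem Submodule.finrank_mul_le (P Q : Submodule k A) [Module.Finite k P] [Module.Finite k Q] :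
    Module.finrank k ↥(P * Q) ≤ Module.finrank k P * Module.finrank k Q := by
  rw [← Module.finrank_tensorProduct]
  exact LinearMap.finrank_le_finrank_of_surjective (mulMap'_surjective P Q)

theorem Submodule.finrank_list_prod_le {a : ℕ} (l : List (Submodule k A))
    (hl : ∀ P ∈ l, Module.Finite k P ∧ Module.finrank k P ≤ a) :
    Module.Finite k l.prod ∧ Module.finrank k l.prod ≤ a ^ l.length := by
  induction l with
  | nil =>
    rw [List.prod_nil, Submodule.one_eq_span, List.length_nil, pow_zero]
    refine ⟨Module.Finite.span_of_finite k (Set.finite_singleton _), ?_⟩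
    exact (finrank_span_le_card (R := k) ({1} : Set A)).trans_eq (by simp)
  | cons P l ih =>
    obtain ⟨hP, hPa⟩ := hl P (by simp)
    obtain ⟨hfin, hla⟩ := ih fun Q hQ ↦ hl Q (by simp [hQ])
    rw [List.prod_cons, List.length_cons, pow_succ']
    refine ⟨?_, (finrank_mul_le P l.prod).trans (Nat.mul_le_mul hPa hla)⟩
    exact Module.Finite.of_surjective _ (mulMap'_surjective P l.prod)

theorem List.mul_prod_map_eq_of_mem {ι R : Type*} [Monoid R] {f : ι → R}
    (hf : ∀ i j, Commute (f i) (f j)) (hf' : ∀ i, f i * f i = f i) {l : List ι} {i : ι}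
    (hi : i ∈ l) : f i * (l.map f).prod = (l.map f).prod := by
  induction l with
  | nil => simp at hi
  | cons j l ih =>
    rw [List.map_cons, List.prod_cons, ← mul_assoc]
    rcases List.mem_cons.1 hi with rfl | hi
    · rw [hf']
    · rw [(hf i j).eq, mul_assoc, ih hi]

/-- If `A` has dimension at least `d * (n + 1)` and is the sum of the `B * u ^ m` for `m ≤ n`,
where `B` has dimension at most `d`, then the powers `u ^ m` are right independent over `B`, and
hence the right multiplications by `u` and `u ^ n` have the expected kernels. -/
theorem mul_eq_zero_of_mul_powerSpan_eq_top {u : A} {n d : ℕ} (hu : u ^ (n + 1) = 0)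
    (B : Submodule k A) [Module.Finite k B] (hB : Module.finrank k B ≤ d)
    (htop : B * powerSpan k u = ⊤) (hA : d * (n + 1) ≤ Module.finrank k A) (x : A) :
    (x * u = 0 → ∃ y, x = y * u ^ n) ∧ (x * u ^ n = 0 → ∃ y, x = y * u) := by
  let φ : (Fin (n + 1) → B) →ₗ[k] A :=
    ∑ m : Fin (n + 1), (LinearMap.mulRight k (u ^ (m : ℕ))).comp (B.subtype.comp (LinearMap.proj m))
  have hφ (b) : φ b = ∑ m, (b m : A) * u ^ (m : ℕ) := by simp [φ]
  have hsurj : Function.Surjective φ := by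
    rw [← LinearMap.range_eq_top, eq_top_iff, ← htop, powerSpan_eq_span_range hu,
      Submodule.mul_le]
    intro b hb v hv
    induction hv using Submodule.span_induction with
    | mem v hv =>
      obtain ⟨m, rfl⟩ := hv
      refine ⟨Pi.single m ⟨b, hb⟩, ?_⟩
      rw [hφ, Finset.sum_eq_single m] <;> simp +contextual
    | zero => simp
    | add v w _ _ hv hw => rw [mul_add]; exact add_mem hv hw
    | smul r v _ hv => rw [mul_smul_comm]; exact Submodule.smul_mem _ _ hv
  have hinj : Function.Injective φ := by
    have hle := LinearMap.finrank_le_finrank_of_surjective hsurj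
    have hdim : Module.finrank k (Fin (n + 1) → B) = (n + 1) * Module.finrank k B := by
      rw [Module.finrank_pi_fintype, Finset.sum_const, Finset.card_univ, Fintype.card_fin,
        smul_eq_mul]
    have : Module.finrank k (Fin (n + 1) → B) = Module.finrank k A := by nlinarith
    have : Module.Finite k A := Module.Finite.of_surjective φ hsurj
    exact (LinearMap.injective_iff_surjective_of_finrank_eq_finrank ‹_›).2 hsurj
  obtain ⟨b, rfl⟩ := hsurj x
  constructor
  · intro h
    have : φ (Fin.cons 0 fun m ↦ b m.castSucc) = 0 := by
      rw [← h, hφ, hφ, Fin.sum_univ_succ, Fin.sum_univ_castSucc, add_mul, mul_assoc, ← pow_succ]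
      simp [Finset.sum_mul, mul_assoc, ← pow_succ, hu]
    rw [map_eq_zero_iff φ hinj] at this
    have hb (m : Fin n) : b m.castSucc = 0 := by
      simpa using congrFun this m.succ
    exact ⟨b (Fin.last n), by simp [hφ, Fin.sum_univ_castSucc, hb]⟩
  · intro h
    have : φ (Fin.snoc 0 (b 0)) = 0 := by
      rw [← h, hφ, hφ, Fin.sum_univ_succ (fun m ↦ (b m : A) * u ^ (m : ℕ)),
        Fin.sum_univ_castSucc, add_mul, Finset.sum_mul]
      rw [Finset.sum_eq_zero, Finset.sum_eq_zero]
      · simp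
      · intro m _
        rw [mul_assoc, ← pow_add, pow_eq_zero_of_le _ hu, mul_zero]
        simp
      · simp
    rw [map_eq_zero_iff φ hinj] at this
    have hb : b 0 = 0 := by simpa using congrFun this (Fin.last n)
    exact ⟨∑ m : Fin n, (b m.succ : A) * u ^ (m : ℕ), by
      simp [hφ, Fin.sum_univ_succ, hb, Finset.sum_mul, mul_assoc, ← pow_succ]⟩

end PowerSpan

namespace QCI

variable {k : Type} [Field k] {c a : ℕ} {q : k}

theorem exists_x_mul_x_skew (hq : q ≠ 0) {i j : Fin c} (hij : i ≠ j) :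
    ∃ r : k, r ≠ 0 ∧ x k c a q i * x k c a q j = r • (x k c a q j * x k c a q i) := by
  rcases hij.lt_or_gt with h | h
  · exact ⟨q, hq, x_mul_x h⟩
  · exact ⟨q⁻¹, inv_ne_zero hq, by rw [x_mul_x h, inv_smul_smul₀ hq]⟩

theorem adjoin_range_x : Algebra.adjoin k (Set.range (x k c a q)) = ⊤ := by
  have h := congrArg (Subalgebra.map (RingQuot.mkAlgHom k (QCIRel k c a q)))
    (FreeAlgebra.adjoin_range_ι k (Fin c))
  rw [AlgHom.map_adjoin, ← Set.range_comp, Algebra.map_top,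
    (AlgHom.range_eq_top _).2 (RingQuot.mkAlgHom_surjective k _)] at h
  exact h

theorem submodule_eq_top {S : Submodule k (QCI k c a q)} (h1 : 1 ∈ S)
    (hx : ∀ i, (k ∙ x k c a q i) * S ≤ S) : S = ⊤ := by
  have key (y : QCI k c a q) : ∀ z ∈ S, y * z ∈ S := by
    have hy : y ∈ Algebra.adjoin k (Set.range (x k c a q)) := by simp [adjoin_range_x]
    induction hy using Algebra.adjoin_induction with
    | mem y hy =>
      obtain ⟨i, rfl⟩ := hy
      exact fun z hz ↦ hx i (Submodule.mul_mem_mul (Submodule.mem_span_singleton_self _) hz)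
    | algebraMap r =>
      intro z hz
      rw [← Algebra.smul_def]
      exact S.smul_mem r hz
    | add y z _ _ hy hz => exact fun w hw ↦ by rw [add_mul]; exact add_mem (hy w hw) (hz w hw)
    | mul y z _ _ hy hz => exact fun w hw ↦ by rw [mul_assoc]; exact hy _ (hz w hw)
  exact eq_top_iff.2 fun y _ ↦ by simpa using key y 1 h1

/-- The span of the ordered monomials in the variables `x_j` with `j ∈ l`. -/
noncomputable def monomialSpan (k : Type) [Field k] (c a : ℕ) (q : k) (l : List (Fin c)) :
    Submodule k (QCI k c a q) :=
  (l.map fun j ↦ powerSpan k (x k c a q j)).prod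

theorem commute_powerSpan_x (hq : q ≠ 0) (i j : Fin c) :
    Commute (powerSpan k (x k c a q i)) (powerSpan k (x k c a q j)) := by
  obtain rfl | hij := eq_or_ne i j
  · exact Commute.refl _
  · obtain ⟨r, hr, h⟩ := exists_x_mul_x_skew hq hij
    exact commute_powerSpan_of_skew hr h

theorem powerSpan_mul_monomialSpan (hq : q ≠ 0) {l : List (Fin c)} {j : Fin c} (hj : j ∈ l) :
    powerSpan k (x k c a q j) * monomialSpan k c a q l = monomialSpan k c a q l :=
  List.mul_prod_map_eq_of_mem (commute_powerSpan_x hq) (fun _ ↦ powerSpan_mul_self _) hj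

theorem monomialSpan_mul_powerSpan (hq : q ≠ 0) {l : List (Fin c)} {j : Fin c} (hj : j ∈ l) :
    monomialSpan k c a q l * powerSpan k (x k c a q j) = monomialSpan k c a q l := by
  refine Eq.trans ?_ (powerSpan_mul_monomialSpan hq hj)
  refine (Commute.list_prod_left _ _ fun P hP ↦ ?_).eq
  obtain ⟨i, -, rfl⟩ := List.mem_map.1 hP
  exact commute_powerSpan_x hq i j

theorem one_mem_monomialSpan (l : List (Fin c)) : 1 ∈ monomialSpan k c a q l := by
  unfold monomialSpan
  induction l with
  | nil => simp [Submodule.one_eq_span]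
  | cons j l ih =>
    rw [List.map_cons, List.prod_cons]
    simpa using Submodule.mul_mem_mul (one_mem_powerSpan (x k c a q j)) ih

theorem commute_span_x_monomialSpan (hq : q ≠ 0) {l : List (Fin c)} {i : Fin c} (hi : i ∉ l) :
    Commute (k ∙ x k c a q i) (monomialSpan k c a q l) := by
  refine Commute.list_prod_right _ _ fun P hP ↦ ?_
  obtain ⟨j, hj, rfl⟩ := List.mem_map.1 hP
  obtain ⟨r, hr, h⟩ := exists_x_mul_x_skew hq (i := i) (j := j) (by rintro rfl; exact hi hj)
  exact commute_span_singleton_powerSpan_of_skew hr h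

theorem monomialSpan_mul_powerSpan_u (hq : q ≠ 0) {lam : Fin c → k} {i : Fin c} (hi : lam i ≠ 0)
    {l : List (Fin c)} (hil : i ∉ l) (hl : ∀ j, j ≠ i → j ∈ l) :
    monomialSpan k c a q l * powerSpan k (u k c a q lam) = ⊤ := by
  refine submodule_eq_top ?_ fun j ↦ ?_
  · simpa using Submodule.mul_mem_mul (one_mem_monomialSpan l) (one_mem_powerSpan _)
  rw [← mul_assoc]
  obtain rfl | hji := eq_or_ne j i
  · rw [(commute_span_x_monomialSpan hq hil).eq]
    have hx : x k c a q j = (lam j)⁻¹ • (u k c a q lam -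
        ∑ m ∈ Finset.univ.erase j, lam m • x k c a q m) := by
      rw [eq_inv_smul_iff₀ hi, u, ← Finset.add_sum_erase _ _ (Finset.mem_univ j),
        add_sub_cancel_right]
    rw [mul_assoc, Submodule.mul_le]
    intro b hb v hv
    obtain ⟨w, hw, rfl⟩ := Submodule.mem_span_singleton_mul.1 hv
    rw [hx, smul_mul_assoc, mul_smul_comm, sub_mul, mul_sub, Finset.sum_mul, Finset.mul_sum]
    refine Submodule.smul_mem _ _ (sub_mem ?_ (Submodule.sum_mem _ fun m hm ↦ ?_))
    · exact Submodule.mul_mem_mul hb (span_singleton_mul_powerSpan_le _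
        (Submodule.mul_mem_mul (Submodule.mem_span_singleton_self _) hw))
    · rw [smul_mul_assoc, mul_smul_comm, ← mul_assoc]
      refine Submodule.smul_mem _ _ (Submodule.mul_mem_mul ?_ hw)
      rw [← monomialSpan_mul_powerSpan hq (hl m (Finset.ne_of_mem_erase hm))]
      exact Submodule.mul_mem_mul hb (self_mem_powerSpan _)
  · refine mul_le_mul_left (α := Submodule k (QCI k c a q)) ?_ _
    rw [← powerSpan_mul_monomialSpan hq (hl j hji), ← mul_assoc]
    exact mul_le_mul_left (span_singleton_mul_powerSpan_le _) _

theorem finrank_monomialSpan_le (l : List (Fin c)) :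
    Module.Finite k (monomialSpan k c a q l) ∧
      Module.finrank k (monomialSpan k c a q l) ≤ a ^ l.length := by
  have h := Submodule.finrank_list_prod_le (a := a)
    (l.map fun j ↦ powerSpan k (x k c a q j)) fun P hP ↦ by
      obtain ⟨j, -, rfl⟩ := List.mem_map.1 hP
      exact ⟨finite_powerSpan (x_pow j), finrank_powerSpan_le (x_pow j)⟩
  rwa [List.length_map] at h

theorem finiteDimensional_and_annihilator (n : ℕ) (hq : IsPrimitiveRoot q (aprime k (n + 1)))
    {lam : Fin c → k} (hlam : lam ≠ 0) :
    FiniteDimensional k (QCI k c (n + 1) q) ∧ ∀ y : QCI k c (n + 1) q,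
      (y * u k c (n + 1) q lam = 0 → ∃ z, y = z * u k c (n + 1) q lam ^ n) ∧
      (y * u k c (n + 1) q lam ^ n = 0 → ∃ z, y = z * u k c (n + 1) q lam) := by
  obtain ⟨i, hi⟩ := Function.ne_iff.1 hlam
  have := nontrivial (k := k) (c := c) (q := q) n.succ_ne_zero
  have hq0 : q ≠ 0 := hq.ne_zero (aprime_ne_zero n.succ_ne_zero)
  have hu := u_pow n.succ_ne_zero hq lam
  have htop := monomialSpan_mul_powerSpan_u (a := n + 1) hq0 hi
    (l := (Finset.univ.erase i).toList) (by simp) (by simp)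
  obtain ⟨hfin, hrank⟩ := finrank_monomialSpan_le (k := k) (a := n + 1) (q := q)
    (Finset.univ.erase i).toList
  have hfinU := finite_powerSpan (k := k) hu
  have hfinA : FiniteDimensional k (QCI k c (n + 1) q) := by
    have := Module.Finite.of_surjective _ (Submodule.mulMap'_surjective
      (monomialSpan k c (n + 1) q (Finset.univ.erase i).toList)
      (powerSpan k (u k c (n + 1) q lam)))
    rw [htop] at this
    exact Module.Finite.equiv (Submodule.topEquiv (R := k) (M := QCI k c (n + 1) q))
  refine ⟨hfinA, mul_eq_zero_of_mul_powerSpan_eq_top hu _ hrank htop ?_⟩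
  refine le_of_eq_of_le ?_ (pow_le_finrank n.succ_ne_zero hq0)
  rw [← pow_succ, Finset.length_toList, Finset.card_erase_of_mem (Finset.mem_univ i),
    Finset.card_univ, Fintype.card_fin, Nat.sub_add_cancel i.pos]

end QCI

section PeriodicResolution

variable {A : Type} [Ring A] (u v : A) (huv : u * v = 0) (hvu : v * u = 0)

/-- The periodic complex `⋯ ⟶ A --u--> A --v--> A` of left modules, with differentials the right
multiplications by `u` and by `v`. -/
noncomputable def periodicComplex : ChainComplex (ModuleCat A) ℕ :=
  HomologicalComplex.alternatingConst (ModuleCat.of A A)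
    (φ := ModuleCat.ofHom (LinearMap.toSpanSingleton A A u))
    (ψ := ModuleCat.ofHom (LinearMap.toSpanSingleton A A v))
    (by ext; simp [huv]) (by ext; simp [hvu]) fun _ _ ↦ ComplexShape.down_nat_odd_add

theorem periodicComplex_d_of_even {n : ℕ} (hn : Even n) :
    (periodicComplex u v huv hvu).d (n + 1) n =
      ModuleCat.ofHom (LinearMap.toSpanSingleton A A v) :=
  (dif_pos (by simp)).trans (dif_neg (Nat.not_even_iff_odd.2 hn.add_one))

theorem periodicComplex_d_of_odd {n : ℕ} (hn : Odd n) :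
    (periodicComplex u v huv hvu).d (n + 1) n =
      ModuleCat.ofHom (LinearMap.toSpanSingleton A A u) :=
  (dif_pos (by simp)).trans (dif_pos hn.add_one)

/-- The augmentation `A ⟶ A u`, `a ↦ a u`. -/
noncomputable def periodicAugmentation :
    ModuleCat.of A A ⟶ ModuleCat.of A (Submodule.span A {u}) :=
  ModuleCat.ofHom (LinearMap.toSpanSingleton A (Submodule.span A {u})
    ⟨u, Submodule.mem_span_singleton_self u⟩)

theorem toSpanSingleton_comp_periodicAugmentation (hvu : v * u = 0) :
    ModuleCat.ofHom (LinearMap.toSpanSingleton A A v) ≫ periodicAugmentation u = 0 := by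
  refine ModuleCat.hom_ext (LinearMap.ext_ring (Subtype.ext ?_))
  change ((1 : A) * v) * u = 0
  rw [one_mul, hvu]

/-- The augmentation of the periodic complex onto `A u`. -/
noncomputable def periodicComplexπ : periodicComplex u v huv hvu ⟶
    (ChainComplex.single₀ (ModuleCat A)).obj (ModuleCat.of A (Submodule.span A {u})) :=
  ((periodicComplex u v huv hvu).toSingle₀Equiv _).symm ⟨periodicAugmentation u, by
    rw [periodicComplex_d_of_even _ _ _ _ Even.zero]
    exact toSpanSingleton_comp_periodicAugmentation u v hvu⟩

theorem periodicComplexπ_f_zero :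
    (periodicComplexπ u v huv hvu).f 0 = periodicAugmentation u :=
  ChainComplex.toSingle₀Equiv_symm_apply_f_zero _ _

theorem quasiIso_periodicComplexπ (hu : ∀ y : A, y * u = 0 → ∃ z, y = z * v)
    (hv : ∀ y : A, y * v = 0 → ∃ z, y = z * u) : QuasiIso (periodicComplexπ u v huv hvu) where
  quasiIsoAt m := by
    induction m with
    | zero =>
      rw [ChainComplex.quasiIsoAt₀_iff, ShortComplex.quasiIso_iff_of_zeros' _ rfl rfl rfl]
      constructor
      · rw [ShortComplex.moduleCat_exact_iff]
        intro (x : A) hx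
        have hx' : periodicAugmentation u x = 0 := by
          rw [← periodicComplexπ_f_zero u v huv hvu]
          exact hx
        obtain ⟨z, rfl⟩ := hu x (congrArg Subtype.val hx')
        exact ⟨z, congrArg (fun f ↦ f z) (periodicComplex_d_of_even u v huv hvu Even.zero)⟩
      · rw [ModuleCat.epi_iff_surjective]
        rintro ⟨y, hy⟩
        obtain ⟨x, rfl⟩ := Submodule.mem_span_singleton.1 hy
        exact ⟨x, congrArg (fun f ↦ f x) (periodicComplexπ_f_zero u v huv hvu)⟩
    | succ m _ =>
      rw [quasiIsoAt_iff_exactAt' (hL := ChainComplex.exactAt_succ_single_obj ..),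
          HomologicalComplex.exactAt_iff' _ (m + 2) (m + 1) m (by simp) (by simp)]
      rw [ShortComplex.moduleCat_exact_iff]
      intro (x : A) hx
      rcases Nat.even_or_odd m with hm | hm
      · replace hx :=
          (congrArg (fun f ↦ f x) (periodicComplex_d_of_even u v huv hvu hm)).symm.trans hx
        obtain ⟨z, rfl⟩ := hv x hx
        exact ⟨z, congrArg (fun f ↦ f z) (periodicComplex_d_of_odd u v huv hvu hm.add_one)⟩
      · replace hx :=
          (congrArg (fun f ↦ f x) (periodicComplex_d_of_odd u v huv hvu hm)).symm.trans hx
        obtain ⟨z, rfl⟩ := hu x hx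
        exact ⟨z, congrArg (fun f ↦ f z) (periodicComplex_d_of_even u v huv hvu hm.add_one)⟩

/-- The periodic projective resolution of `A u`, when the right multiplications by `u` and by `v`
have the image of each other as kernels. -/
noncomputable def periodicResolution (hu : ∀ y : A, y * u = 0 → ∃ z, y = z * v)
    (hv : ∀ y : A, y * v = 0 → ∃ z, y = z * u) :
    ProjectiveResolution (ModuleCat.of A (Submodule.span A {u})) where
  complex := periodicComplex u v huv hvu
  projective _ := inferInstanceAs (Projective (ModuleCat.of A A))
  π := periodicComplexπ u v huv hvu
  quasiIso := quasiIso_periodicComplexπ u v huv hvu hu hv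

theorem subsingleton_ext_one_iff (k : Type) [Field k] [Algebra k A] (huv : u * v = 0)
    (hvu : v * u = 0) (hu : ∀ y : A, y * u = 0 → ∃ z, y = z * v)
    (hv : ∀ y : A, y * v = 0 → ∃ z, y = z * u) (M : Type) [AddCommGroup M] [Module A M] :
    Subsingleton (((Ext k (ModuleCat A) 1).obj
      (Opposite.op (ModuleCat.of A (Submodule.span A {u})))).obj (ModuleCat.of A M)) ↔
    ∀ m : M, u • m = 0 → ∃ m', m = v • m' := by
  rw [← ModuleCat.isZero_iff_subsingleton,
    ((periodicResolution u v huv hvu hu hv).isoExt 1 (ModuleCat.of A M)).isZero_iff,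
    ← HomologicalComplex.exactAt_iff_isZero_homology,
    HomologicalComplex.exactAt_iff' _ 0 1 2 (by simp) (by simp), ShortComplex.moduleCat_exact_iff]
  have h₁ (f : ModuleCat.of A A ⟶ ModuleCat.of A M) :
      ((periodicResolution u v huv hvu hu hv).complex.linearYonedaObj k
          (ModuleCat.of A M)).d 0 1 f =
        ModuleCat.ofHom (LinearMap.toSpanSingleton A A v) ≫ f :=
    congrArg (· ≫ f) (periodicComplex_d_of_even u v huv hvu Even.zero)
  have h₂ (f : ModuleCat.of A A ⟶ ModuleCat.of A M) :
      ((periodicResolution u v huv hvu hu hv).complex.linearYonedaObj k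
          (ModuleCat.of A M)).d 1 2 f =
        ModuleCat.ofHom (LinearMap.toSpanSingleton A A u) ≫ f :=
    congrArg (· ≫ f) (periodicComplex_d_of_odd u v huv hvu odd_one)
  constructor
  · intro h m hm
    obtain ⟨(f : ModuleCat.of A A ⟶ ModuleCat.of A M), hf⟩ :=
      h (ModuleCat.ofHom (LinearMap.toSpanSingleton A M m)) ((h₂ _).trans (by
        refine ModuleCat.hom_ext (LinearMap.ext_ring ?_)
        change ((1 : A) * u) • m = 0
        rw [one_mul, hm]))
    replace hf : f ((1 : A) * v) = (1 : A) • m :=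
      congrArg (fun g : ModuleCat.of A A ⟶ ModuleCat.of A M ↦ g (1 : A)) ((h₁ f).symm.trans hf)
    refine ⟨f (1 : A), ?_⟩
    rw [one_mul, one_smul] at hf
    rw [← hf, ← map_smul]
    exact congrArg f (mul_one v).symm
  · intro h (f : ModuleCat.of A A ⟶ ModuleCat.of A M) hf
    replace hf : f ((1 : A) * u) = (0 : M) :=
      congrArg (fun g : ModuleCat.of A A ⟶ ModuleCat.of A M ↦ g (1 : A)) ((h₂ f).symm.trans hf)
    rw [one_mul] at hf
    obtain ⟨m, hm⟩ := h (f (1 : A)) (by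
      rw [← hf, ← map_smul]
      exact congrArg f (mul_one u))
    refine ⟨ModuleCat.ofHom (LinearMap.toSpanSingleton A M m), (h₁ _).trans ?_⟩
    refine ModuleCat.hom_ext (LinearMap.ext_ring ?_)
    change ((1 : A) * v) • m = f (1 : A)
    rw [one_mul, hm]

end PeriodicResolution

section Projective

open IsLocalRing
open scoped IsMulCommutative

/-- Over a local ring with nilpotent principal maximal ideal `(t)`, where the annihilator of `t` is
`(t ^ n)`, projectivity of a module is detected by the exactness of `t` and `t ^ n` on it. -/
theorem Module.projective_iff_forall_smul_eq_zero {R : Type} [CommRing R] [IsLocalRing R] {t : R}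
    (n : ℕ) (ht : maximalIdeal R = Ideal.span {t}) (htn : t ^ (n + 1) = 0)
    (hann : ∀ r : R, r * t = 0 → ∃ s, r = t ^ n * s)
    (M : Type) [AddCommGroup M] [Module R M] [Module.FinitePresentation R M] :
    Module.Projective R M ↔ ∀ m : M, t • m = 0 → ∃ m', m = t ^ n • m' := by
  constructor
  · rintro ⟨s, hs⟩ m hm
    have h (x : M) : t * s m x = 0 := by
      rw [← smul_eq_mul, ← Finsupp.smul_apply, ← map_smul, hm, map_zero, Finsupp.zero_apply]
    choose r hr using fun x ↦ hann (s m x) (by rw [mul_comm, h x])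
    refine ⟨∑ x ∈ (s m).support, r x • x, ?_⟩
    conv_lhs => rw [← hs m, Finsupp.linearCombination_apply, Finsupp.sum]
    simp [Finset.smul_sum, smul_smul, ← hr]
  · intro h
    have : Module.Free R M := by
      refine Module.free_of_maximalIdeal_rTensor_injective ?_
      rw [injective_iff_map_eq_zero]
      intro z hz
      have hmem : t ∈ maximalIdeal R := ht ▸ Ideal.mem_span_singleton_self t
      obtain ⟨m, rfl⟩ : ∃ m : M, z = (⟨t, hmem⟩ : maximalIdeal R) ⊗ₜ[R] m := by
        clear hz
        induction z with
        | zero => exact ⟨0, by simp⟩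
        | tmul x y =>
          obtain ⟨x, hx⟩ := x
          obtain ⟨r, rfl⟩ := Ideal.mem_span_singleton'.1 (ht ▸ hx)
          exact ⟨r • y, by rw [TensorProduct.tmul_smul, TensorProduct.smul_tmul']; rfl⟩
        | add x y hx hy =>
          obtain ⟨m, rfl⟩ := hx
          obtain ⟨m', rfl⟩ := hy
          exact ⟨m + m', (TensorProduct.tmul_add _ _ _).symm⟩
      obtain ⟨m', rfl⟩ := h m (by
        simpa using congrArg (TensorProduct.lid R M) hz)
      have h0 : t ^ n • (⟨t, hmem⟩ : maximalIdeal R) = 0 :=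
        Subtype.ext ((pow_succ t n).symm.trans htn)
      rw [TensorProduct.tmul_smul, TensorProduct.smul_tmul', h0, TensorProduct.zero_tmul]
    infer_instance

theorem Algebra.adjoin_singleton_projective_iff (k : Type) [Field k] {A : Type} [Ring A]
    [Algebra k A] [FiniteDimensional k A] {u : A} {n : ℕ} (hu : u ^ (n + 1) = 0) (hu' : u ^ n ≠ 0)
    (M : Type) [AddCommGroup M] [Module A M] [Module.Finite A M] :
    Module.Projective (Algebra.adjoin k {u}) M ↔ ∀ m : M, u • m = 0 → ∃ m', m = u ^ n • m' := by
  have hnt : Nontrivial A := ⟨⟨_, _, hu'⟩⟩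
  have hexists (r : Algebra.adjoin k {u}) : ∃ p : Polynomial k, Polynomial.aeval u p = r := by
    obtain ⟨r, hr⟩ := r
    rwa [Algebra.adjoin_singleton_eq_range_aeval] at hr
  set t : Algebra.adjoin k {u} := ⟨u, Algebra.self_mem_adjoin_singleton k u⟩ with t_def
  have ht : t ^ (n + 1) = 0 := Subtype.ext hu
  have hdecomp (r : Algebra.adjoin k {u}) :
      ∃ (a : k) (s : Algebra.adjoin k {u}), r = algebraMap _ _ a + s * t := by
    obtain ⟨p, hp⟩ := hexists r
    refine ⟨p.coeff 0, ⟨Polynomial.aeval u p.divX, Polynomial.aeval_mem_adjoin_singleton k u⟩, ?_⟩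
    ext
    rw [← hp]
    conv_lhs => rw [← p.divX_mul_X_add]
    simp [t_def, add_comm]
  have hnil (s : Algebra.adjoin k {u}) : (s * t) ^ (n + 1) = 0 := by
    rw [mul_pow, ht, mul_zero]
  have hunit (a : k) (ha : a ≠ 0) (s : Algebra.adjoin k {u}) :
      IsUnit (algebraMap _ (Algebra.adjoin k {u}) a + s * t) :=
    IsNilpotent.isUnit_add_left_of_commute ⟨_, hnil s⟩
      ((IsUnit.mk0 a ha).map _) (mul_comm _ _)
  have hloc : IsLocalRing (Algebra.adjoin k {u}) := by
    refine IsLocalRing.of_isUnit_or_isUnit_one_sub_self fun r ↦ ?_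
    obtain ⟨a, s, rfl⟩ := hdecomp r
    by_cases ha : a = 0
    · right
      have := hunit 1 one_ne_zero (-s)
      subst ha
      simpa [sub_eq_add_neg] using this
    · exact .inl (hunit a ha s)
  have hmax : maximalIdeal (Algebra.adjoin k {u}) = Ideal.span {t} := by
    ext r
    rw [Ideal.mem_span_singleton', mem_maximalIdeal, mem_nonunits_iff]
    constructor
    · intro hr
      obtain ⟨a, s, rfl⟩ := hdecomp r
      have ha : a = 0 := of_not_not fun ha ↦ hr (hunit a ha s)
      exact ⟨s, by simp [ha]⟩
    · rintro ⟨s, rfl⟩ h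
      exact not_isUnit_zero (hnil s ▸ h.pow (n + 1))
  have hann (r : Algebra.adjoin k {u}) (hr : r * t = 0) : ∃ s, r = t ^ n * s := by
    obtain ⟨p, hp⟩ := hexists r
    have hmin : minpoly k u ∣ Polynomial.X ^ (n + 1) := minpoly.dvd k u (by simp [hu])
    obtain ⟨i, hi, hi'⟩ := (dvd_prime_pow Polynomial.prime_X _).1 hmin
    have hin : i = n + 1 := by
      by_contra hne
      have h0 := minpoly.aeval k u
      have : Polynomial.aeval u (Polynomial.X ^ n : Polynomial k) = 0 := by
        obtain ⟨w, hw⟩ := hi'.dvd.trans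
          (pow_dvd_pow (Polynomial.X : Polynomial k) (show i ≤ n by omega))
        rw [hw, map_mul, h0, zero_mul]
      exact hu' (by simpa using this)
    subst hin
    have h0 : Polynomial.aeval u (p * Polynomial.X) = 0 := by
      rw [map_mul, hp, Polynomial.aeval_X]
      exact congrArg Subtype.val hr
    have hdvd := hi'.symm.dvd.trans (minpoly.dvd k u h0)
    rw [pow_succ] at hdvd
    obtain ⟨w, rfl⟩ := (mul_dvd_mul_iff_right Polynomial.X_ne_zero).1 hdvd
    refine ⟨⟨Polynomial.aeval u w, Polynomial.aeval_mem_adjoin_singleton k u⟩, ?_⟩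
    ext
    rw [← hp]
    simp [t_def]
  have hfin : Module.Finite (Algebra.adjoin k {u}) M := by
    have : Module.Finite (Algebra.adjoin k {u}) A := .of_restrictScalars_finite k _ _
    exact .trans A M
  have hnoeth : IsNoetherianRing (Algebra.adjoin k {u}) := isNoetherian_of_tower k inferInstance
  have := Module.finitePresentation_of_finite (Algebra.adjoin k {u}) M
  exact Module.projective_iff_forall_smul_eq_zero n hmax ht hann M

end Projective

/-- For nonzero `λ ∈ k^c` and a finitely generated left `A`-module `M`, the module `M` is
projective over the subalgebra `k[u_λ]` of `A` generated by `u_λ` if and only if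
`Ext^1_A(Au_λ, M) = 0`. -/
theorem projective_adjoin_iff_ext_one_subsingleton (k : Type) [Field k] [IsAlgClosed k]
    (a c : ℕ) (ha : 2 ≤ a) (hc : 1 ≤ c) (q : k) (hq : IsPrimitiveRoot q (aprime k a))
    (lam : Fin c → k) (hlam : lam ≠ 0)
    (M : Type) [AddCommGroup M] [Module (QCI k c a q) M] [Module.Finite (QCI k c a q) M] :
    Module.Projective (Algebra.adjoin k {QCI.u k c a q lam}) M ↔
      Subsingleton (((Ext k (ModuleCat (QCI k c a q)) 1).obj
          (Opposite.op (ModuleCat.of (QCI k c a q)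
            (Submodule.span (QCI k c a q) {QCI.u k c a q lam})))).obj
        (ModuleCat.of (QCI k c a q) M)) := by
  obtain ⟨n, rfl⟩ : ∃ n, a = n + 1 := ⟨a - 1, by omega⟩
  have hnt : Nontrivial (QCI k c (n + 1) q) := QCI.nontrivial n.succ_ne_zero
  obtain ⟨hfin, hann⟩ := QCI.finiteDimensional_and_annihilator n hq hlam
  have hu : QCI.u k c (n + 1) q lam ^ (n + 1) = 0 := QCI.u_pow n.succ_ne_zero hq lam
  have hu' : QCI.u k c (n + 1) q lam ^ n ≠ 0 := by
    intro h
    obtain ⟨z, hz⟩ := (hann 1).2 (by rw [h, mul_zero])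
    have hpow (m : ℕ) : z ^ m * QCI.u k c (n + 1) q lam ^ m = 1 := by
      induction m with
      | zero => simp
      | succ m ih =>
        rw [pow_succ, pow_succ', mul_assoc, ← mul_assoc z, ← hz, one_mul, ih]
    simpa [h] using hpow n
  rw [Algebra.adjoin_singleton_projective_iff k hu hu',
    subsingleton_ext_one_iff _ (QCI.u k c (n + 1) q lam ^ n) k ((pow_succ' _ _).symm.trans hu)
      ((pow_succ _ _).symm.trans hu) (fun y ↦ (hann y).1) fun y ↦ (hann y).2]
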